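/- Let k ≥ 1 and let J = {j_1 < ... < j_k} be a k-element subset of {1,...,n} with j_s ≥ 2s for all s. Let N(σ_J) denote the set of maximal elements, with respect to ⪯, of the set {σ' ∈ S_n² : σ' ≺ σ_J and σ' has fewer than k arcs}. Then N(σ_J) = { σ_{J∖{j_l}} : l ∈ {1,...,k} with l = k, or j_s − j_l ≥ 2(s−l) for every s with l < s ≤ k } (note that J∖{j_l} again satisfies the condition j'_s ≥ 2s, so σ_{J∖{j_l}} is defined). -/

import Mathlib

namespace LinkPat

variable {n : ℕ}

/-- `σ` is an involution (σ² = id). -/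
def IsInvol (σ : Equiv.Perm (Fin n)) : Prop := ∀ p, σ (σ p) = p

/-- `(i,j)` is an arc of `σ`: `i < j` and `σ i = j`. -/
def IsArc (σ : Equiv.Perm (Fin n)) (i j : Fin n) : Prop := i < j ∧ σ i = j

/-- The finite set of arcs of `σ`. -/
def arcs (σ : Equiv.Perm (Fin n)) : Finset (Fin n × Fin n) :=
  Finset.univ.filter fun a => a.1 < a.2 ∧ σ a.1 = a.2

/-- The number of arcs of `σ`. -/
def numArcs (σ : Equiv.Perm (Fin n)) : ℕ := (arcs σ).card

/-- `c(σ)`: the number of crossings, i.e. pairs of arcs `(i,j)`, `(i',j')` with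
`i < i' < j < j'`. -/
def crossNum (σ : Equiv.Perm (Fin n)) : ℕ :=
  ((arcs σ ×ˢ arcs σ).filter fun x => x.1.1 < x.2.1 ∧ x.2.1 < x.1.2 ∧ x.1.2 < x.2.2).card

/-- `f(σ)`: the sum over fixed points `p` of the number of arcs over `p`. -/
def fixNum (σ : Equiv.Perm (Fin n)) : ℕ :=
  (((Finset.univ.filter fun p => σ p = p) ×ˢ arcs σ).filter
    fun x => x.2.1 < x.1 ∧ x.1 < x.2.2).card

/-- The rank matrix `R_σ`: entry `(i,j)` is the number of arcs inside `[i,j]`. -/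
def Rmat (σ : Equiv.Perm (Fin n)) (i j : Fin n) : ℕ :=
  ((arcs σ).filter fun a => i ≤ a.1 ∧ a.2 ≤ j).card

/-- The partial order `σ' ⪯ σ` given by pointwise comparison of rank matrices. -/
def rle (σ' σ : Equiv.Perm (Fin n)) : Prop := ∀ i j, Rmat σ' i j ≤ Rmat σ i j

/-- The strict order `σ' ≺ σ`. -/
def rlt (σ' σ : Equiv.Perm (Fin n)) : Prop := rle σ' σ ∧ σ' ≠ σ

end LinkPat

namespace LinkPat

/-- The condition `j_s ≥ 2s` for every element of `J` (`j ∈ J` being the `s`-th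
smallest element, `s = #{x ∈ J : x ≤ j}`); points are `1`-based, i.e. the point
corresponding to `j : Fin n` is `(j : ℕ) + 1`. -/
def JCond {n : ℕ} (J : Finset (Fin n)) : Prop :=
  ∀ j ∈ J, 2 * (J.filter fun x => x ≤ j).card ≤ (j : ℕ) + 1

/-- `σ` is the greedy involution `σ_J` associated to `J`: `σ` is an involution, the
larger endpoints of its arcs are exactly the elements of `J`, and for `j ∈ J` the
partner `σ j` is the largest `d < j` which is neither in `J` nor a partner `σ j'`
of some earlier `j' ∈ J`, `j' < j`. -/
def GreedyInv {n : ℕ} (σ : Equiv.Perm (Fin n)) (J : Finset (Fin n)) : Prop :=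
  IsInvol σ ∧ (∀ p : Fin n, σ p < p ↔ p ∈ J) ∧
  ∀ j ∈ J, ∀ d : Fin n, σ j < d → d < j → d ∈ J ∨ ∃ j' ∈ J, j' < j ∧ σ j' = d

end LinkPat

namespace LinkPat

variable {n : ℕ} {σ τ : Equiv.Perm (Fin n)} {J : Finset (Fin n)}

lemma mem_arcs {a : Fin n × Fin n} : a ∈ arcs σ ↔ a.1 < a.2 ∧ σ a.1 = a.2 := by
  simp [arcs]

/-- No two arcs of `σ` cross. -/
def NonCrossing (σ : Equiv.Perm (Fin n)) : Prop :=
  ∀ i j, i < j → j < σ i → σ i < σ j → False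

/-- The arc `a` of `σ` is not nested strictly beneath another arc of `σ`. -/
def IsOutermost (σ : Equiv.Perm (Fin n)) (a : Fin n × Fin n) : Prop :=
  a ∈ arcs σ ∧ ∀ b ∈ arcs σ, b.1 < a.1 → b.2 ≤ a.2

/-- The arcs of `σ` contained in the window `[i,j]`. -/
def arcsIn (σ : Equiv.Perm (Fin n)) (i j : Fin n) : Finset (Fin n × Fin n) :=
  (arcs σ).filter fun a => i ≤ a.1 ∧ a.2 ≤ j

lemma mem_arcsIn {a : Fin n × Fin n} {i j : Fin n} :
    a ∈ arcsIn σ i j ↔ a ∈ arcs σ ∧ i ≤ a.1 ∧ a.2 ≤ j := by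
  simp [arcsIn]

lemma Rmat_eq_card (i j : Fin n) : Rmat σ i j = (arcsIn σ i j).card := rfl

lemma eq_of_arcs_eq (hσ : IsInvol σ) (hτ : IsInvol τ) (h : arcs σ = arcs τ) : σ = τ := by
  have key : ∀ i j, i < j → (σ i = j ↔ τ i = j) := by
    intro i j hij
    have : (i, j) ∈ arcs σ ↔ (i, j) ∈ arcs τ := by rw [h]
    simpa [mem_arcs, hij] using this
  ext1 p
  rcases lt_trichotomy p (σ p) with hp | hp | hp
  · exact ((key p _ hp).1 rfl).symm
  · rcases lt_trichotomy p (τ p) with hq | hq | hq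
    · exact (key p _ hq).2 rfl
    · rw [← hp, ← hq]
    · have := (key (τ p) p hq).2 (hτ p)
      rw [← this, hσ, this]
  · have := (key (σ p) p hp).1 (hσ p)
    have h2 := hτ (σ p)
    rw [this] at h2
    exact h2.symm

lemma rle_antisymm (hσ : IsInvol σ) (hτ : IsInvol τ) (h₁ : rle σ τ) (h₂ : rle τ σ) :
    σ = τ := by
  apply eq_of_arcs_eq hσ hτ
  have key : ∀ m : ℕ, ∀ a : Fin n × Fin n, (a.2 : ℕ) - a.1 = m →
      (a ∈ arcs σ ↔ a ∈ arcs τ) := by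
    intro m
    induction m using Nat.strong_induction_on with
    | _ m ih =>
      rintro ⟨i, j⟩ hm
      have hlt : ∀ b : Fin n × Fin n, i ≤ b.1 → b.2 ≤ j → b.1 < b.2 → b ≠ (i, j) →
          (b ∈ arcs σ ↔ b ∈ arcs τ) := by
        rintro ⟨c, d⟩ hc hd hcd hne
        refine ih (d - c) ?_ (c, d) rfl
        simp only [ne_eq, Prod.mk.injEq, not_and] at *
        by_cases hci : c = i
        · have := hne hci
          omega
        · omega
      have aux : ∀ ρ ρ' : Equiv.Perm (Fin n), Rmat ρ i j ≤ Rmat ρ' i j →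
          (∀ b : Fin n × Fin n, i ≤ b.1 → b.2 ≤ j → b.1 < b.2 → b ≠ (i, j) →
            (b ∈ arcs ρ' → b ∈ arcs ρ)) → (i, j) ∈ arcs ρ → (i, j) ∈ arcs ρ' := by
        intro ρ ρ' hle hsub hmem
        by_contra hcon
        have : arcsIn ρ' i j ⊂ arcsIn ρ i j := by
          rw [Finset.ssubset_iff_of_subset]
          · exact ⟨(i, j), mem_arcsIn.2 ⟨hmem, le_rfl, le_rfl⟩,
              fun h => hcon (mem_arcsIn.1 h).1⟩
          · intro b hb
            rw [mem_arcsIn] at hb ⊢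
            refine ⟨hsub b hb.2.1 hb.2.2 (mem_arcs.1 hb.1).1 ?_ hb.1, hb.2⟩
            rintro rfl
            exact hcon hb.1
        exact absurd (Finset.card_lt_card this) (not_lt.2 hle)
      exact ⟨aux σ τ (h₁ i j) fun b p q r s => (hlt b p q r s).2,
        aux τ σ (h₂ i j) fun b p q r s => (hlt b p q r s).1⟩
  ext a
  exact key _ a rfl

lemma Rmat_hull_eq {i j c d : Fin n} (h : rle τ σ) (h₁ : Rmat τ i j = Rmat σ i j)
    (h₂ : Rmat τ c d = Rmat σ c d)
    (hcov : arcsIn σ (min i c) (max j d) ⊆ arcsIn σ i j ∪ arcsIn σ c d) :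
    Rmat τ (min i c) (max j d) = Rmat σ (min i c) (max j d) := by
  apply le_antisymm (h _ _)
  have hinter : ∀ ρ : Equiv.Perm (Fin n),
      arcsIn ρ i j ∩ arcsIn ρ c d = arcsIn ρ (max i c) (min j d) := by
    intro ρ
    ext a
    simp only [Finset.mem_inter, mem_arcsIn, max_le_iff, le_min_iff]
    tauto
  have hsub : arcsIn τ i j ∪ arcsIn τ c d ⊆ arcsIn τ (min i c) (max j d) := by
    intro a
    simp only [Finset.mem_union, mem_arcsIn, min_le_iff, le_max_iff]
    tauto
  have e₁ := Finset.card_union_add_card_inter (arcsIn σ i j) (arcsIn σ c d)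
  have e₂ := Finset.card_union_add_card_inter (arcsIn τ i j) (arcsIn τ c d)
  have l₁ := Finset.card_le_card hcov
  have l₂ := Finset.card_le_card hsub
  have l₃ := h (max i c) (min j d)
  rw [hinter] at e₁ e₂
  simp only [Rmat_eq_card] at *
  omega

lemma exists_outermost_above {e : Fin n × Fin n} (he : e ∈ arcs σ) :
    ∃ a, IsOutermost σ a ∧ a.1 ≤ e.1 ∧ e.2 ≤ a.2 := by
  obtain ⟨a, ha, hmin⟩ := Finset.exists_min_image
    ((arcs σ).filter fun b => b.1 ≤ e.1 ∧ e.2 ≤ b.2) (fun b => b.1) ⟨e, by simp [he]⟩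
  simp only [Finset.mem_filter] at ha hmin
  refine ⟨a, ⟨ha.1, fun b hb hlt => ?_⟩, ha.2⟩
  by_contra hcon
  exact absurd (hmin b ⟨hb, by omega, by omega⟩) (not_le.2 hlt)

lemma arc_eq_of_fst_eq {a b : Fin n × Fin n} (ha : a ∈ arcs σ) (hb : b ∈ arcs σ)
    (h : a.1 = b.1) : a = b :=
  Prod.ext h (by rw [← (mem_arcs.1 ha).2, ← (mem_arcs.1 hb).2, h])

lemma arc_eq_of_snd_eq {a b : Fin n × Fin n} (ha : a ∈ arcs σ) (hb : b ∈ arcs σ)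
    (h : a.2 = b.2) : a = b :=
  Prod.ext (σ.injective (by rw [(mem_arcs.1 ha).2, (mem_arcs.1 hb).2, h])) h

lemma NonCrossing.snd_le_snd (hnc : NonCrossing σ) {a b : Fin n × Fin n} (ha : a ∈ arcs σ)
    (hb : b ∈ arcs σ) (h₁ : a.1 < b.1) (h₂ : b.1 < a.2) : b.2 ≤ a.2 := by
  by_contra hcon
  rw [mem_arcs] at ha hb
  exact hnc a.1 b.1 h₁ (by rw [ha.2]; exact h₂) (by rw [ha.2, hb.2]; exact not_le.1 hcon)

/-- An arc which neither lies beneath an outermost arc `a` nor ends before `a` begins lies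
entirely to the right of `a`. -/
lemma IsOutermost.lt_fst (hσ : IsInvol σ) (hnc : NonCrossing σ) {a f : Fin n × Fin n}
    (ha : IsOutermost σ a) (hf : f ∈ arcs σ) (h₁ : a.1 < f.2)
    (h₂ : ¬ (a.1 ≤ f.1 ∧ f.2 ≤ a.2)) : a.2 < f.1 := by
  rcases lt_trichotomy f.1 a.1 with h | h | h
  · have h₃ := ha.2 f hf h
    have h₄ := hnc.snd_le_snd hf ha.1 h h₁
    obtain rfl := arc_eq_of_snd_eq hf ha.1 (le_antisymm h₃ h₄)
    exact absurd h (lt_irrefl _)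
  · obtain rfl := arc_eq_of_fst_eq hf ha.1 h
    exact absurd ⟨le_rfl, le_rfl⟩ h₂
  · by_contra hcon
    rcases lt_or_eq_of_le (not_lt.1 hcon) with h' | h'
    · exact h₂ ⟨h.le, hnc.snd_le_snd ha.1 hf h h'⟩
    · have h₃ := mem_arcs.1 hf
      have h₄ := mem_arcs.1 ha.1
      have h₅ := hσ a.1
      rw [h₄.2, ← h', h₃.2] at h₅
      omega

/-- If `τ ⪯ σ` has fewer arcs than the noncrossing involution `σ`, then some outermost arc of
`σ` lies only in windows on which the ranks of `τ` and `σ` differ. -/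
lemma exists_outermost_Rmat_lt (hσ : IsInvol σ) (hnc : NonCrossing σ) (h : rle τ σ)
    (hlt : numArcs τ < numArcs σ) :
    ∃ a, IsOutermost σ a ∧ ∀ i j, i ≤ a.1 → a.2 ≤ j → Rmat τ i j < Rmat σ i j := by
  by_contra! hcon
  have key : ∀ m : ℕ, (∃ g ∈ arcs σ, (g.2 : ℕ) < m) → ∃ i j, Rmat τ i j = Rmat σ i j ∧
      ∀ e ∈ arcs σ, (e.2 : ℕ) < m → i ≤ e.1 ∧ e.2 ≤ j := by
    intro m
    induction m with
    | zero => rintro ⟨g, -, hg⟩; omega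
    | succ m ih =>
      intro hex
      by_cases hm : ∃ e ∈ arcs σ, (e.2 : ℕ) = m
      · obtain ⟨e, he, hem⟩ := hm
        obtain ⟨a, ha, hae₁, hae₂⟩ := exists_outermost_above he
        obtain ⟨c, d, hc, hd, hle⟩ := hcon a ha
        have htight := le_antisymm (h c d) hle
        have heq : ∀ f ∈ arcs σ, (f.2 : ℕ) < m + 1 → (f.2 : ℕ) < m ∨ f = e := by
          intro f hf hfm
          by_cases hf' : (f.2 : ℕ) < m
          · exact Or.inl hf'
          · exact Or.inr (arc_eq_of_snd_eq hf he (by omega))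
        have hece : c ≤ e.1 ∧ e.2 ≤ d := ⟨hc.trans hae₁, hae₂.trans hd⟩
        by_cases hg : ∃ g ∈ arcs σ, (g.2 : ℕ) < m
        · obtain ⟨i, j, hij, hall⟩ := ih hg
          obtain ⟨g, hgσ, hgm⟩ := hg
          refine ⟨min i c, max j d, Rmat_hull_eq h hij htight ?_, ?_⟩
          · intro f hf
            rw [mem_arcsIn, min_le_iff, le_max_iff] at hf
            simp only [Finset.mem_union, mem_arcsIn]
            by_contra! hf'
            have hW := hf'.1 hf.1
            have hW' := hf'.2 hf.1
            have hfm : m ≤ (f.2 : ℕ) := by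
              by_contra hh
              have := hall f hf.1 (by omega)
              exact absurd this.2 (not_le.2 (hW this.1))
            have hright : a.2 < f.1 := by
              refine ha.lt_fst hσ hnc hf.1 ?_ ?_
              · have := (mem_arcs.1 he).1
                omega
              · rintro ⟨p, q⟩
                exact absurd (q.trans hd) (not_le.2 (hW' (hc.trans p)))
            have ha' := (mem_arcs.1 ha.1).1
            have hg' := (mem_arcs.1 hgσ).1
            have hfd := hW' (by omega)
            have hgW := hall g hgσ hgm
            have hfi : i ≤ f.1 := by omega
            have := hW hfi
            omega
          · intro f hf hfm
            rw [min_le_iff, le_max_iff]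
            rcases heq f hf hfm with h' | rfl
            · have := hall f hf h'
              exact ⟨Or.inl this.1, Or.inl this.2⟩
            · exact ⟨Or.inr hece.1, Or.inr hece.2⟩
        · refine ⟨c, d, htight, fun f hf hfm => ?_⟩
          rcases heq f hf hfm with h' | rfl
          · exact absurd ⟨f, hf, h'⟩ hg
          · exact hece
      · have hstep : ∀ f ∈ arcs σ, (f.2 : ℕ) < m + 1 → (f.2 : ℕ) < m := by
          intro f hf hfm
          have : (f.2 : ℕ) ≠ m := fun h' => hm ⟨f, hf, h'⟩
          omega
        obtain ⟨g, hg, hgm⟩ := hex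
        obtain ⟨i, j, hij, hall⟩ := ih ⟨g, hg, hstep g hg hgm⟩
        exact ⟨i, j, hij, fun f hf hfm => hall f hf (hstep f hf hfm)⟩
  have hne : (arcs σ).Nonempty := Finset.card_pos.1 (by unfold numArcs at hlt; omega)
  obtain ⟨g, hg⟩ := hne
  obtain ⟨i, j, hij, hall⟩ := key n ⟨g, hg, g.2.isLt⟩
  have hfull : arcsIn σ i j = arcs σ :=
    Finset.filter_true_of_mem fun e he => hall e he e.2.isLt
  have hle : Rmat τ i j ≤ numArcs τ := Finset.card_le_card (Finset.filter_subset _ _)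
  rw [hij, Rmat_eq_card, hfull] at hle
  exact absurd hle (not_le.2 hlt)

lemma GreedyInv.lt_iff (hg : GreedyInv σ J) (p : Fin n) : p < σ p ↔ σ p ∈ J := by
  rw [← hg.2.1, hg.1]

lemma GreedyInv.mem_arcs_iff (hg : GreedyInv σ J) {a : Fin n × Fin n} :
    a ∈ arcs σ ↔ a.2 ∈ J ∧ σ a.2 = a.1 := by
  rw [mem_arcs]
  constructor
  · rintro ⟨h₁, h₂⟩
    refine ⟨?_, by rw [← h₂, hg.1]⟩
    rw [← h₂, ← hg.lt_iff, h₂]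
    exact h₁
  · rintro ⟨h₁, h₂⟩
    refine ⟨?_, by rw [← h₂, hg.1]⟩
    rw [← h₂]
    exact (hg.2.1 _).2 h₁

lemma GreedyInv.numArcs_eq (hg : GreedyInv σ J) : numArcs σ = J.card := by
  have : arcs σ = J.image fun j => (σ j, j) := by
    ext ⟨i, j⟩
    rw [hg.mem_arcs_iff]
    simp only [Finset.mem_image, Prod.mk.injEq]
    constructor
    · rintro ⟨h₁, h₂⟩
      exact ⟨j, h₁, h₂, rfl⟩
    · rintro ⟨_, h₁, h₂, rfl⟩
      exact ⟨h₁, h₂⟩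
  rw [numArcs, this, Finset.card_image_of_injective]
  intro x y hxy
  exact (Prod.mk.inj hxy).2

lemma GreedyInv.apply_lt_and_ne_of_under (hg : GreedyInv σ J) {j d : Fin n} (hj : j ∈ J)
    (h₁ : σ j < d) (h₂ : d < j) : σ d < j ∧ σ d ≠ d := by
  rcases hg.2.2 j hj d h₁ h₂ with h | ⟨j', hj', hlt, rfl⟩
  · have := (hg.2.1 d).2 h
    exact ⟨this.trans h₂, this.ne⟩
  · rw [hg.1]
    exact ⟨hlt, ((hg.2.1 j').2 hj').ne'⟩

lemma GreedyInv.nonCrossing (hg : GreedyInv σ J) : NonCrossing σ := by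
  intro i j h₁ h₂ h₃
  have hi : σ i ∈ J := (hg.lt_iff i).1 (h₁.trans h₂)
  have := (hg.apply_lt_and_ne_of_under hi (by rwa [hg.1]) h₂).1
  exact absurd this (not_lt.2 h₃.le)

lemma GreedyInv.unique (hσ : GreedyInv σ J) (hτ : GreedyInv τ J) : σ = τ := by
  have key : ∀ j ∈ J, σ j = τ j := by
    intro j
    induction j using WellFoundedLT.induction with
    | _ j ih =>
      intro hj
      have aux : ∀ {ρ ρ' : Equiv.Perm (Fin n)}, GreedyInv ρ J → GreedyInv ρ' J →
          (∀ x < j, x ∈ J → ρ x = ρ' x) → ¬ ρ j < ρ' j := by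
        intro ρ ρ' hρ hρ' hx hlt
        have hj' := (hρ'.2.1 j).2 hj
        rcases hρ.2.2 j hj (ρ' j) hlt hj' with h | ⟨x, hxJ, hxj, hxe⟩
        · have := (hρ'.2.1 _).2 h
          rw [hρ'.1] at this
          exact absurd this (not_lt.2 hj'.le)
        · rw [hx x hxj hxJ] at hxe
          exact hxj.ne (ρ'.injective hxe)
      exact le_antisymm (not_lt.1 (aux hτ hσ fun x hx hxJ => (ih x hx hxJ).symm))
        (not_lt.1 (aux hσ hτ ih))
  apply eq_of_arcs_eq hσ.1 hτ.1
  ext a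
  rw [hσ.mem_arcs_iff, hτ.mem_arcs_iff]
  exact and_congr_right fun h => by rw [key _ h]

/-- The involution obtained from `σ` by removing the arc ending in `j`. -/
def removeArc (σ : Equiv.Perm (Fin n)) (j : Fin n) : Equiv.Perm (Fin n) :=
  σ * Equiv.swap (σ j) j

lemma removeArc_apply (hσ : IsInvol σ) (j p : Fin n) :
    removeArc σ j p = if p = j ∨ p = σ j then p else σ p := by
  unfold removeArc
  rw [Equiv.Perm.mul_apply]
  by_cases h₁ : p = j
  · subst h₁
    simp [hσ p]
  · by_cases h₂ : p = σ j
    · subst h₂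
      simp
    · rw [Equiv.swap_apply_of_ne_of_ne h₂ h₁]
      simp [h₁, h₂]

lemma removeArc_isInvol (hσ : IsInvol σ) (j : Fin n) : IsInvol (removeArc σ j) := by
  intro p
  simp only [removeArc_apply hσ]
  have h₁ := hσ p
  have h₂ := hσ j
  grind

lemma arcs_removeArc (hσ : IsInvol σ) {j : Fin n} (hj : σ j < j) :
    arcs (removeArc σ j) = (arcs σ).erase (σ j, j) := by
  ext ⟨p, q⟩
  simp only [mem_arcs, Finset.mem_erase, removeArc_apply hσ, ne_eq, Prod.mk.injEq]
  have h₁ := hσ p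
  have h₂ := hσ j
  grind

lemma Rmat_removeArc (hσ : IsInvol σ) {j : Fin n} (hj : σ j < j) (p q : Fin n) :
    Rmat (removeArc σ j) p q =
      if p ≤ σ j ∧ j ≤ q then Rmat σ p q - 1 else Rmat σ p q := by
  have : arcsIn (removeArc σ j) p q = (arcsIn σ p q).erase (σ j, j) := by
    simp only [arcsIn, arcs_removeArc hσ hj, Finset.filter_erase]
  rw [Rmat_eq_card, this, Rmat_eq_card]
  split_ifs with h
  · exact Finset.card_erase_of_mem (mem_arcsIn.2 ⟨mem_arcs.2 ⟨hj, hσ j⟩, h⟩)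
  · rw [Finset.erase_eq_of_notMem]
    exact fun h' => h (mem_arcsIn.1 h').2

lemma GreedyInv.lt_apply_of_isOutermost (hg : GreedyInv σ J) {j x : Fin n}
    (hj : IsOutermost σ (σ j, j)) (hx : x ∈ J) (h : j < x) : j < σ x := by
  refine hj.lt_fst hg.1 hg.nonCrossing (f := (σ x, x))
    (hg.mem_arcs_iff.2 ⟨hx, rfl⟩) ((mem_arcs.1 hj.1).1.trans h) ?_
  rintro ⟨-, h'⟩
  exact absurd h' (not_le.2 h)

lemma GreedyInv.removeArc (hg : GreedyInv σ J) {j : Fin n} (hj : IsOutermost σ (σ j, j)) :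
    GreedyInv (removeArc σ j) (J.erase j) := by
  have hlt : σ j < j := (mem_arcs.1 hj.1).1
  refine ⟨removeArc_isInvol hg.1 j, fun p => ?_, fun x hx d h₁ h₂ => ?_⟩
  · rw [removeArc_apply hg.1, Finset.mem_erase, ← hg.2.1]
    have := hg.1 j
    grind
  · rw [Finset.mem_erase] at hx
    have hxj : x ≠ σ j := by
      rintro rfl
      have := (hg.2.1 _).2 hx.2
      rw [hg.1] at this
      exact absurd this (not_lt.2 hlt.le)
    rw [removeArc_apply hg.1, if_neg (by tauto)] at h₁
    have hout : j < x → j < σ x := hg.lt_apply_of_isOutermost hj hx.2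
    rcases hg.2.2 x hx.2 d h₁ h₂ with h | ⟨y, hy, hyx, hyd⟩
    · left
      rw [Finset.mem_erase]
      refine ⟨?_, h⟩
      rintro rfl
      exact absurd (hout h₂) (not_lt.2 h₁.le)
    · right
      have hyj : y ≠ j := by
        rintro rfl
        have := hout hyx
        omega
      refine ⟨y, Finset.mem_erase.2 ⟨hyj, hy⟩, hyx, ?_⟩
      rw [removeArc_apply hg.1, if_neg, hyd]
      rintro (h | rfl)
      · exact hyj h
      · have := (hg.2.1 _).2 hy
        rw [hg.1] at this
        exact absurd this (not_lt.2 hlt.le)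

/-- The arc ending in `j` is outermost iff every segment starting just after `j` and ending in
`J` consists at most by half of elements of `J`. -/
lemma GreedyInv.isOutermost_iff (hg : GreedyInv σ J) {j : Fin n} (hj : j ∈ J) :
    IsOutermost σ (σ j, j) ↔ ∀ j' ∈ J, j < j' →
      2 * (J.filter fun x => j < x ∧ x ≤ j').card ≤ (j' : ℕ) - (j : ℕ) := by
  have hsplit : ∀ j' : Fin n, (J.filter fun x => j < x ∧ x ≤ j').card +
      ((Finset.Ioc j j').filter fun x => x ∉ J).card = (j' : ℕ) - (j : ℕ) := by
    intro j'
    rw [← Fin.card_Ioc, ← Finset.card_filter_add_card_filter_not (s := Finset.Ioc j j') (· ∈ J)]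
    congr 2
    ext x
    simp only [Finset.mem_filter, Finset.mem_Ioc]
    tauto
  constructor
  · intro ho j' hj' hlt
    have : (J.filter fun x => j < x ∧ x ≤ j').card ≤
        ((Finset.Ioc j j').filter fun x => x ∉ J).card := by
      refine Finset.card_le_card_of_injOn σ (fun x hx => ?_) σ.injective.injOn
      simp only [Finset.coe_filter, Set.mem_ofPred_eq, Finset.mem_Ioc] at hx ⊢
      have hx' := (hg.2.1 x).2 hx.1
      refine ⟨⟨hg.lt_apply_of_isOutermost ho hx.1 hx.2.1, hx'.le.trans hx.2.2⟩, fun h => ?_⟩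
      have := (hg.2.1 _).2 h
      rw [hg.1] at this
      exact absurd this (not_lt.2 hx'.le)
    have := hsplit j'
    omega
  · intro hcond
    refine ⟨hg.mem_arcs_iff.2 ⟨hj, rfl⟩, ?_⟩
    rintro ⟨i', j'⟩ hb hlt
    dsimp only at hlt ⊢
    by_contra hcon
    rw [not_le] at hcon
    obtain ⟨hj', hi'⟩ := hg.mem_arcs_iff.1 hb
    dsimp only at hj' hi'
    have hc := hcond j' hj' hcon
    have hlt' : ((Finset.Ioc j j').filter fun x => x ∉ J).card ≤
        ((J.filter fun x => j < x ∧ x ≤ j').erase j').card := by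
      refine Finset.card_le_card_of_injOn σ (fun x hx => ?_) σ.injective.injOn
      simp only [Finset.coe_filter, Set.mem_ofPred_eq, Finset.mem_Ioc, Finset.coe_erase,
        Set.mem_sdiff, Set.mem_singleton_iff] at hx ⊢
      have hxj' : x < j' := lt_of_le_of_ne hx.1.2 (by rintro rfl; exact hx.2 hj')
      have hjlt := (hg.2.1 j).2 hj
      have hix : σ j' < x := by rw [hi']; omega
      obtain ⟨h₁, h₂⟩ := hg.apply_lt_and_ne_of_under hj' hix hxj'
      have h₃ : x < σ x := by
        have := mt (hg.2.1 x).1 hx.2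
        omega
      exact ⟨⟨(hg.lt_iff x).1 h₃, hx.1.1.trans h₃, h₁.le⟩, h₁.ne⟩
    have hmem : j' ∈ J.filter fun x => j < x ∧ x ≤ j' := by simp [hj', hcon]
    have hpos := Finset.card_pos.2 ⟨j', hmem⟩
    rw [Finset.card_erase_of_mem hmem] at hlt'
    have := hsplit j'
    omega

lemma GreedyInv.removeArc_below (hg : GreedyInv σ J) {j : Fin n} (hj : j ∈ J) :
    IsInvol (LinkPat.removeArc σ j) ∧ rlt (LinkPat.removeArc σ j) σ ∧
      numArcs (LinkPat.removeArc σ j) < J.card := by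
  have hlt := (hg.2.1 j).2 hj
  refine ⟨removeArc_isInvol hg.1 j, ⟨fun p q => ?_, fun h => ?_⟩, ?_⟩
  · rw [Rmat_removeArc hg.1 hlt]
    split_ifs <;> omega
  · have := removeArc_apply hg.1 j j
    rw [h, if_pos (Or.inl rfl)] at this
    exact hlt.ne this
  · rw [← hg.numArcs_eq, numArcs, numArcs, arcs_removeArc hg.1 hlt]
    exact Finset.card_erase_lt_of_mem (mem_arcs.2 ⟨hlt, hg.1 j⟩)

lemma GreedyInv.exists_rle_removeArc (hg : GreedyInv σ J) (h : rle τ σ)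
    (hlt : numArcs τ < J.card) :
    ∃ j ∈ J, IsOutermost σ (σ j, j) ∧ rle τ (LinkPat.removeArc σ j) := by
  obtain ⟨⟨i, j⟩, ha, hR⟩ := exists_outermost_Rmat_lt hg.1 hg.nonCrossing h
    (by rwa [hg.numArcs_eq])
  obtain ⟨hj, hi⟩ := hg.mem_arcs_iff.1 ha.1
  dsimp only at hj hi
  subst hi
  refine ⟨j, hj, ha, fun p q => ?_⟩
  rw [Rmat_removeArc hg.1 ((hg.2.1 j).2 hj)]
  split_ifs with hpq
  · have := hR p q hpq.1 hpq.2
    omega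
  · exact h p q

lemma GreedyInv.eq_of_removeArc_rle (hg : GreedyInv σ J) {j j' : Fin n} (hj : j ∈ J)
    (hj' : j' ∈ J) (ho : IsOutermost σ (σ j, j))
    (h : rle (LinkPat.removeArc σ j) (LinkPat.removeArc σ j')) : j = j' := by
  have hlt := (hg.2.1 j).2 hj
  have hlt' := (hg.2.1 j').2 hj'
  have hR := h (σ j') j'
  rw [Rmat_removeArc hg.1 hlt, Rmat_removeArc hg.1 hlt'] at hR
  simp only [le_refl, and_self, if_true] at hR
  have hpos : 0 < Rmat σ (σ j') j' :=
    Finset.card_pos.2 ⟨(σ j', j'), mem_arcsIn.2 ⟨mem_arcs.2 ⟨hlt', hg.1 j'⟩, le_rfl, le_rfl⟩⟩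
  split_ifs at hR with hin
  · by_contra hne
    have := hg.lt_apply_of_isOutermost ho hj' (lt_of_le_of_ne hin.2 hne)
    omega
  · omega

end LinkPat

/-- the maximal elements below `σ_J` among involutions with fewer than
`k` arcs are exactly the greedy involutions `σ_{J∖{j_l}}` for those `l` with
`l = k` or `j_s − j_l ≥ 2(s−l)` for all `l < s ≤ k`. -/
theorem greedy_maximal_below (n k : ℕ) (hk : 1 ≤ k)
    (J : Finset (Fin n)) (hcard : J.card = k) (hJ : LinkPat.JCond J)
    (σJ : Equiv.Perm (Fin n)) (hg : LinkPat.GreedyInv σJ J) :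
    ∀ σ' : Equiv.Perm (Fin n),
      ((LinkPat.IsInvol σ' ∧ LinkPat.rlt σ' σJ ∧ LinkPat.numArcs σ' < k) ∧
        ∀ τ : Equiv.Perm (Fin n),
          (LinkPat.IsInvol τ ∧ LinkPat.rlt τ σJ ∧ LinkPat.numArcs τ < k) →
          LinkPat.rle σ' τ → τ = σ')
      ↔
      ∃ j ∈ J,
        ((∀ j' ∈ J, j' ≤ j) ∨
         ∀ j' ∈ J, j < j' →
           2 * (J.filter fun x => j < x ∧ x ≤ j').card ≤ (j' : ℕ) - (j : ℕ)) ∧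
        LinkPat.GreedyInv σ' (J.erase j) := by
  intro σ'
  subst hcard
  have hiff : ∀ j ∈ J, ((∀ j' ∈ J, j' ≤ j) ∨
      ∀ j' ∈ J, j < j' →
        2 * (J.filter fun x => j < x ∧ x ≤ j').card ≤ (j' : ℕ) - (j : ℕ)) ↔
      LinkPat.IsOutermost σJ (σJ j, j) := by
    intro j hj
    rw [hg.isOutermost_iff hj, or_iff_right_iff_imp]
    intro h j' hj' hlt
    exact absurd (h j' hj') (not_le.2 hlt)
  constructor
  · rintro ⟨⟨-, hlt, hnum⟩, hmax⟩
    obtain ⟨j, hj, ho, hle⟩ := hg.exists_rle_removeArc hlt.1 hnum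
    refine ⟨j, hj, (hiff j hj).2 ho, ?_⟩
    rw [← hmax _ (hg.removeArc_below hj) hle]
    exact hg.removeArc ho
  · rintro ⟨j, hj, hcond, hg'⟩
    have ho := (hiff j hj).1 hcond
    obtain rfl := hg'.unique (hg.removeArc ho)
    refine ⟨hg.removeArc_below hj, ?_⟩
    rintro τ ⟨hτ, hlt, hnum⟩ hle
    obtain ⟨j', hj', -, hle'⟩ := hg.exists_rle_removeArc hlt.1 hnum
    obtain rfl := hg.eq_of_removeArc_rle hj hj' ho fun p q => (hle p q).trans (hle' p q)
    exact LinkPat.rle_antisymm hτ hg'.1 hle' hle
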